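/- Lemma 3 (denominator bound, adaptive case). For the mixture empirical prior and the α-power posterior with denominator D_n = Σ_{S : |S| ≤ T_n} w_n(S) ∫_{Θ_S} R_n(θ)^α π_{n,S}(θ) ν_{n,S}(dθ), the deterministic inequality D_n ≥ e^{-d |S_n*|} · w_n(S_n*) · R_n(θ̂_{n,S_n*})^α · Π_{n,S_n*}(𝓛_{n,S_n*}) holds, where 𝓛_{n,S} = {θ ∈ Θ_S : L_n(θ) ≥ e^{-d|S|} L_n(θ̂_{n,S})}. -/

import Mathlib

open MeasureTheory Real Finset

/-- Lemma 3 (denominator bound, adaptive case).  For the mixture empirical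
prior `Π_n = Σ_{S : |S| ≤ T_n} w_n(S) Π_{n,S}` and the α-power posterior with
denominator `D_n = Σ_S w_n(S) ∫_{Θ_S} R_n(θ)^α π_{n,S}(θ) ν_{n,S}(dθ)`, one has
the deterministic inequality
`D_n ≥ e^{-d|S*|} w_n(S*) R_n(θ̂_{n,S*})^α Π_{n,S*}(𝓛_{n,S*})`, where
`𝓛_{n,S} = {θ ∈ Θ_S : L_n(θ) ≥ e^{-d|S|} L_n(θ̂_{n,S})}` and `θ̂_{n,S}` is the
`S`-specific sieve MLE. -/
theorem denominator_bound_adaptive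
    {Θ : Type*} [MeasurableSpace Θ]
    (Tn : ℕ)
    (w : Finset ℕ → ℝ) (hw : ∀ S, 0 ≤ w S)        -- prior on index sets
    (ΘS : Finset ℕ → Set Θ)                        -- the model pieces Θ_S
    (νS : Finset ℕ → Measure Θ)                    -- fixed dominating measures
    (πS : Finset ℕ → Θ → ℝ)                        -- conditional prior densities
    (hπS : ∀ S θ, 0 ≤ πS S θ)
    (L : Θ → ℝ) (hL : ∀ θ, 0 < L θ)                -- likelihood
    (θstar : Θ)                                    -- true parameter
    (R : Θ → ℝ) (hR : ∀ θ, R θ = L θ / L θstar)    -- likelihood ratio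
    (θhat : Finset ℕ → Θ)                          -- S-specific sieve MLEs
    (hθhat : ∀ S, θhat S ∈ ΘS S)
    (hmle : ∀ S, ∀ θ ∈ ΘS S, L θ ≤ L (θhat S))
    (α d : ℝ) (hα : α ∈ Set.Ioo (0 : ℝ) 1) (hd : 0 < d)
    (𝓛 : Finset ℕ → Set Θ)
    (h𝓛 : ∀ S, 𝓛 S = {θ ∈ ΘS S |
      L θ ≥ Real.exp (-(d * S.card)) * L (θhat S)})
    (hΘSmeas : ∀ S, MeasurableSet (ΘS S))
    (h𝓛meas : ∀ S, MeasurableSet (𝓛 S))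
    (Sstar : Finset ℕ)                             -- the "true model"
    (hSstar : Sstar ⊆ Finset.Icc 1 Tn)
    (hInt : ∀ S, IntegrableOn (fun θ => R θ ^ α * πS S θ) (ΘS S) (νS S))
    (hIntπ : IntegrableOn (πS Sstar) (𝓛 Sstar) (νS Sstar)) :
    (∑ S ∈ (Finset.Icc 1 Tn).powerset,
        w S * ∫ θ in ΘS S, R θ ^ α * πS S θ ∂(νS S)) ≥
      Real.exp (-(d * Sstar.card)) * w Sstar * R (θhat Sstar) ^ α *
        (∫ θ in 𝓛 Sstar, πS Sstar θ ∂(νS Sstar)) := by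
  have hRpos : ∀ θ, 0 < R θ := fun θ => by
    rw [hR]
    exact div_pos (hL θ) (hL θstar)
  have hsub : 𝓛 Sstar ⊆ ΘS Sstar := by
    rw [h𝓛]
    exact Set.sep_subset _ _
  have hnonneg : ∀ S θ, 0 ≤ R θ ^ α * πS S θ := fun S θ =>
    mul_nonneg (rpow_nonneg (hRpos θ).le _) (hπS S θ)
  have hpow : ∀ θ ∈ 𝓛 Sstar,
      Real.exp (-(d * Sstar.card)) * R (θhat Sstar) ^ α ≤ R θ ^ α := by
    intro θ hθ
    rw [h𝓛] at hθ
    have hRθ : Real.exp (-(d * Sstar.card)) * R (θhat Sstar) ≤ R θ := by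
      rw [hR, hR, ← mul_div_assoc]
      exact div_le_div_of_nonneg_right hθ.2 (hL θstar).le
    have hexp_le_one : Real.exp (-(d * Sstar.card)) ≤ 1 :=
      Real.exp_le_one_iff.2 (neg_nonpos.2 (by positivity))
    calc Real.exp (-(d * Sstar.card)) * R (θhat Sstar) ^ α
        ≤ Real.exp (-(d * Sstar.card)) ^ α * R (θhat Sstar) ^ α := by
          refine mul_le_mul_of_nonneg_right ?_ (rpow_nonneg (hRpos _).le _)
          exact self_le_rpow_of_le_one (Real.exp_pos _).le hexp_le_one hα.2.le
      _ = (Real.exp (-(d * Sstar.card)) * R (θhat Sstar)) ^ α :=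
          (mul_rpow (Real.exp_pos _).le (hRpos _).le).symm
      _ ≤ R θ ^ α :=
          rpow_le_rpow (mul_pos (Real.exp_pos _) (hRpos _)).le hRθ hα.1.le
  have hintegral : Real.exp (-(d * Sstar.card)) * R (θhat Sstar) ^ α *
      (∫ θ in 𝓛 Sstar, πS Sstar θ ∂(νS Sstar)) ≤
        ∫ θ in ΘS Sstar, R θ ^ α * πS Sstar θ ∂(νS Sstar) := by
    rw [← integral_const_mul]
    calc _ ≤ ∫ θ in 𝓛 Sstar, R θ ^ α * πS Sstar θ ∂(νS Sstar) :=
          setIntegral_mono_on (hIntπ.const_mul _) ((hInt Sstar).mono_set hsub)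
            (h𝓛meas Sstar) fun θ hθ =>
              mul_le_mul_of_nonneg_right (hpow θ hθ) (hπS Sstar θ)
      _ ≤ _ := setIntegral_mono_set (hInt Sstar)
          (Filter.Eventually.of_forall (hnonneg Sstar)) hsub.eventuallyLE
  calc Real.exp (-(d * Sstar.card)) * w Sstar * R (θhat Sstar) ^ α *
        (∫ θ in 𝓛 Sstar, πS Sstar θ ∂(νS Sstar))
      = w Sstar * (Real.exp (-(d * Sstar.card)) * R (θhat Sstar) ^ α *
          (∫ θ in 𝓛 Sstar, πS Sstar θ ∂(νS Sstar))) := by ring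
    _ ≤ w Sstar * ∫ θ in ΘS Sstar, R θ ^ α * πS Sstar θ ∂(νS Sstar) :=
        mul_le_mul_of_nonneg_left hintegral (hw Sstar)
    _ ≤ _ := Finset.single_le_sum
        (f := fun S => w S * ∫ θ in ΘS S, R θ ^ α * πS S θ ∂(νS S))
        (fun S _ => mul_nonneg (hw S) (integral_nonneg (hnonneg S)))
        (Finset.mem_powerset.2 hSstar)
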